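/- If G is a non-locally compact k-gentle paratopological group, then either every remainder of G has the Baire property, or every remainder of G is σ-compact. -/

import Mathlib

open Set

universe u

open Filter Topology in
theorem aux_closed {X : Type u} [TopologicalSpace X] {C : Set X} (hC : IsClosed C)
    {f : Ultrafilter X} {x : X} (hx : (f : Filter X) ≤ 𝓝 x) (h : C ∈ f) : x ∈ C :=
  isClosed_iff_ultrafilter.1 hC x f hx h

open Filter Topology in
/-- A sequence of points of the `U n` has a cluster point in the intersection. -/
theorem aux_seq {G : Type u} [TopologicalSpace G] (U : ℕ → Set G)
    (hUc : ∀ n, IsClosed (U n)) (hUa : Antitone U)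
    (hUu : ∀ f : Ultrafilter G, (∀ n, U n ∈ f) → ∃ x, (f : Filter G) ≤ 𝓝 x)
    (y : ℕ → G) (hy : ∀ n, y n ∈ U n) (M : Set G) (hM : IsClosed M) (hyM : ∀ n, y n ∈ M) :
    ∃ x ∈ M, ∀ n, x ∈ U n := by
  set f : Ultrafilter G := Ultrafilter.map y (hyperfilter ℕ) with hf
  have h1 : ∀ n, U n ∈ f := by
    intro n
    have : ∀ᶠ m in (hyperfilter ℕ : Filter ℕ), y m ∈ U n := by
      have h2 : ∀ᶠ m in (atTop : Filter ℕ), y m ∈ U n := by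
        filter_upwards [eventually_ge_atTop n] with m hm using hUa hm (hy m)
      exact Nat.hyperfilter_le_atTop h2
    exact this
  have h2 : M ∈ f := by
    have : ∀ᶠ m in (hyperfilter ℕ : Filter ℕ), y m ∈ M := Eventually.of_forall hyM
    exact this
  obtain ⟨x, hx⟩ := hUu f h1
  exact ⟨x, aux_closed hM hx h2, fun n => aux_closed (hUc n) hx (h1 n)⟩

open Filter Topology in
theorem aux_compactK {G : Type u} [TopologicalSpace G] (U : ℕ → Set G)
    (hUc : ∀ n, IsClosed (U n))
    (hUu : ∀ f : Ultrafilter G, (∀ n, U n ∈ f) → ∃ x, (f : Filter G) ≤ 𝓝 x) :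
    IsCompact (⋂ n, U n) := by
  rw [isCompact_iff_ultrafilter_le_nhds]
  intro f hf
  have h1 : ∀ n, U n ∈ f := fun n =>
    mem_of_superset (le_principal_iff.1 hf) (iInter_subset _ n)
  obtain ⟨x, hx⟩ := hUu f h1
  exact ⟨x, mem_iInter.2 fun n => aux_closed (hUc n) hx (h1 n), hx⟩

open Filter Topology in
theorem aux_compactL {G : Type u} [TopologicalSpace G] (U : ℕ → Set G)
    (hUc : ∀ n, IsClosed (U n)) (hUa : Antitone U)
    (hUu : ∀ f : Ultrafilter G, (∀ n, U n ∈ f) → ∃ x, (f : Filter G) ≤ 𝓝 x)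
    (y : ℕ → G) (hy : ∀ n, y n ∈ U n) :
    IsCompact ((⋂ n, U n) ∪ range y) := by
  rw [isCompact_iff_ultrafilter_le_nhds]
  intro f hf
  by_cases h1 : ∀ n, U n ∈ f
  · obtain ⟨x, hx⟩ := hUu f h1
    exact ⟨x, Or.inl (mem_iInter.2 fun n => aux_closed (hUc n) hx (h1 n)), hx⟩
  · push Not at h1
    obtain ⟨n, hn⟩ := h1
    have h2 : (U n)ᶜ ∈ f := Ultrafilter.compl_mem_iff_notMem.2 hn
    have h3 : y '' (Iio n) ∈ f := by
      filter_upwards [h2, le_principal_iff.1 hf] with x hx hx'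
      rcases hx' with hx' | ⟨m, rfl⟩
      · exact absurd (mem_iInter.1 hx' n) hx
      · refine ⟨m, ?_, rfl⟩
        by_contra hc
        exact hx (hUa (not_lt.1 hc) (hy m))
    have h4 : IsCompact (y '' (Iio n)) := ((finite_Iio n).image y).isCompact
    obtain ⟨x, ⟨m, _, rfl⟩, hx⟩ := isCompact_iff_ultrafilter_le_nhds.1 h4 f (le_principal_iff.2 h3)
    exact ⟨_, Or.inr ⟨m, rfl⟩, hx⟩

open Filter Topology in
theorem aux_inv {G : Type u} [TopologicalSpace G] [T3Space G] [Group G] [ContinuousMul G]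
    (hk : ∀ K : Set G, IsCompact K → IsCompact ((fun x => x⁻¹) '' K))
    (U : ℕ → Set G) (hU1 : ∀ n, U n ∈ 𝓝 1)
    (hUc : ∀ n, IsClosed (U n)) (hUa : Antitone U)
    (hUu : ∀ f : Ultrafilter G, (∀ n, U n ∈ f) → ∃ x, (f : Filter G) ≤ 𝓝 x) :
    IsTopologicalGroup G := by
  have key : ∀ C : Set G, IsClosed C → ∀ K, IsCompact K → IsCompact ({x | x⁻¹ ∈ C} ∩ K) := by
    intro C hC K hK
    have := hk _ ((hk K hK).inter_left hC)
    convert this using 1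
    ext x
    constructor
    · rintro ⟨h1, h2⟩
      exact ⟨x⁻¹, ⟨h1, x, h2, rfl⟩, inv_inv x⟩
    · rintro ⟨_, ⟨h1, z, h2, rfl⟩, rfl⟩
      simp only [inv_inv] at *
      exact ⟨h1, h2⟩
  have h1 : Tendsto (fun x : G => x⁻¹) (𝓝 1) (𝓝 1) := by
    by_contra hcon
    obtain ⟨N, hN, hN2⟩ : ∃ N ∈ 𝓝 (1 : G), (fun x : G => x⁻¹) ⁻¹' N ∉ 𝓝 (1 : G) := by
      by_contra! h
      exact hcon fun N hN => h N hN
    obtain ⟨N', hN'N, hN'o, hN'1⟩ := mem_nhds_iff.1 hN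
    set C := N'ᶜ with hC
    have hCc : IsClosed C := hN'o.isClosed_compl
    set K := ⋂ n, U n with hKdef
    have hK : IsCompact K := aux_compactK U hUc hUu
    have hCK := key C hCc K hK
    have hO : ({x | x⁻¹ ∈ C} ∩ K)ᶜ ∈ 𝓝 (1 : G) := by
      refine hCK.isClosed.isOpen_compl.mem_nhds ?_
      rintro ⟨h, -⟩
      simp only [mem_ofPred_eq, inv_one] at h
      exact h hN'1
    obtain ⟨N0, hN0, hN0c, hN0s⟩ := exists_mem_nhds_isClosed_subset hO
    have hex : ∀ n, ∃ y, y ∈ U n ∧ y ∈ N0 ∧ y⁻¹ ∈ C := by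
      intro n
      by_contra! h
      apply hN2
      filter_upwards [hU1 n, hN0] with x hx hx'
      have := h x hx hx'
      rw [hC, mem_compl_iff, not_not] at this
      exact hN'N this
    choose y hyU hyN hyC using hex
    have hL := aux_compactL U hUc hUa hUu y hyU
    have hM := ((key C hCc _ hL).inter_left hN0c).isClosed
    obtain ⟨x, hxM, hxU⟩ := aux_seq U hUc hUa hUu y hyU _ hM
      (fun n => ⟨hyN n, hyC n, Or.inr ⟨n, rfl⟩⟩)
    exact hN0s hxM.1 ⟨hxM.2.1, mem_iInter.2 hxU⟩
  have h2 : ContinuousInv G := by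
    refine ⟨continuous_iff_continuousAt.2 fun x₀ => ?_⟩
    have ha : Tendsto (fun x : G => x₀⁻¹ * x) (𝓝 x₀) (𝓝 1) := by
      have : Continuous (fun x : G => x₀⁻¹ * x) := by fun_prop
      simpa using this.tendsto x₀
    have hb := (h1.comp ha).mul_const x₀⁻¹
    simpa [ContinuousAt, Function.comp_def] using hb
  exact {}

open Filter Topology in
theorem aux_cover {G : Type u} [TopologicalSpace G] (U : ℕ → Set G)
    (hUc : ∀ n, IsClosed (U n)) (hUa : Antitone U)
    (hUu : ∀ f : Ultrafilter G, (∀ n, U n ∈ f) → ∃ x, (f : Filter G) ≤ 𝓝 x)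
    (W : G → Set G) (hW : ∀ x, W x ∈ 𝓝 x) : ∃ n, ∃ t : Finset G, U n ⊆ ⋃ x ∈ t, W x := by
  obtain ⟨t, -, ht⟩ := (aux_compactK U hUc hUu).elim_nhds_subcover (fun x => interior (W x))
    (fun x _ => interior_mem_nhds.2 (hW x))
  by_contra! h
  have h' : ∀ n, ∃ y, y ∈ U n ∧ y ∉ ⋃ x ∈ t, W x := fun n => not_subset.1 (h n t)
  choose y hy hy' using h'
  obtain ⟨x, hx, hxU⟩ := aux_seq U hUc hUa hUu y hy (⋃ x ∈ t, interior (W x))ᶜ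
    (isOpen_biUnion fun x _ => isOpen_interior).isClosed_compl
    (fun n hn => hy' n (by
      simp only [mem_iUnion] at hn ⊢
      obtain ⟨i, hi, h⟩ := hn
      exact ⟨i, hi, interior_subset h⟩))
  exact hx (ht (mem_iInter.2 hxU))

open Filter Topology in
theorem aux_left {G : Type u} [TopologicalSpace G] [Group G] [IsTopologicalGroup G]
    (U : ℕ → Set G)
    (hUc : ∀ n, IsClosed (U n)) (hUa : Antitone U)
    (hUu : ∀ f : Ultrafilter G, (∀ n, U n ∈ f) → ∃ x, (f : Filter G) ≤ 𝓝 x)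
    (F : Ultrafilter G) (hF : ∀ n, ∃ y : G, {x | y⁻¹ * x ∈ U n} ∈ F)
    (W : Set G) (hW : W ∈ 𝓝 1) : ∃ E ∈ F, ∀ a ∈ E, ∀ b ∈ E, a⁻¹ * b ∈ W := by
  have hc : ∀ h : G, Tendsto (fun p : G × G => p.1⁻¹ * p.2) (𝓝 h ×ˢ 𝓝 h) (𝓝 1) := by
    intro h
    have : Continuous (fun p : G × G => p.1⁻¹ * p.2) := by fun_prop
    simpa [nhds_prod_eq] using this.tendsto (h, h)
  have hc' : ∀ h : G, ∃ S ∈ 𝓝 h, ∀ a ∈ S, ∀ b ∈ S, a⁻¹ * b ∈ W := by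
    intro h
    obtain ⟨S, hS, hS'⟩ := mem_prod_same_iff.1 (hc h hW)
    exact ⟨S, hS, fun a ha b hb => hS' (mk_mem_prod ha hb)⟩
  choose S hS hSW using hc'
  obtain ⟨n, t, ht⟩ := aux_cover U hUc hUa hUu S hS
  obtain ⟨y, hy⟩ := hF n
  have h1 : (⋃ x ∈ (t : Set G), {z | y⁻¹ * z ∈ S x}) ∈ F := by
    filter_upwards [hy] with z hz
    simpa using ht hz
  rw [Ultrafilter.finite_biUnion_mem_iff t.finite_toSet] at h1
  obtain ⟨x, -, hx⟩ := h1
  refine ⟨_, hx, fun a ha b hb => ?_⟩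
  have := hSW x _ ha _ hb
  simpa [mul_assoc] using this

open Filter Topology in
theorem aux_right {G : Type u} [TopologicalSpace G] [Group G] [IsTopologicalGroup G]
    (U : ℕ → Set G)
    (hUc : ∀ n, IsClosed (U n)) (hUa : Antitone U)
    (hUu : ∀ f : Ultrafilter G, (∀ n, U n ∈ f) → ∃ x, (f : Filter G) ≤ 𝓝 x)
    (F : Ultrafilter G) (hF : ∀ n, ∃ y : G, {x | x * y⁻¹ ∈ U n} ∈ F)
    (W : Set G) (hW : W ∈ 𝓝 1) : ∃ E ∈ F, ∀ a ∈ E, ∀ b ∈ E, a * b⁻¹ ∈ W := by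
  have hc : ∀ h : G, Tendsto (fun p : G × G => p.1 * p.2⁻¹) (𝓝 h ×ˢ 𝓝 h) (𝓝 1) := by
    intro h
    have : Continuous (fun p : G × G => p.1 * p.2⁻¹) := by fun_prop
    simpa [nhds_prod_eq] using this.tendsto (h, h)
  have hc' : ∀ h : G, ∃ S ∈ 𝓝 h, ∀ a ∈ S, ∀ b ∈ S, a * b⁻¹ ∈ W := by
    intro h
    obtain ⟨S, hS, hS'⟩ := mem_prod_same_iff.1 (hc h hW)
    exact ⟨S, hS, fun a ha b hb => hS' (mk_mem_prod ha hb)⟩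
  choose S hS hSW using hc'
  obtain ⟨n, t, ht⟩ := aux_cover U hUc hUa hUu S hS
  obtain ⟨y, hy⟩ := hF n
  have h1 : (⋃ x ∈ (t : Set G), {z | z * y⁻¹ ∈ S x}) ∈ F := by
    filter_upwards [hy] with z hz
    simpa using ht hz
  rw [Ultrafilter.finite_biUnion_mem_iff t.finite_toSet] at h1
  obtain ⟨x, -, hx⟩ := h1
  refine ⟨_, hx, fun a ha b hb => ?_⟩
  have := hSW x _ ha _ hb
  simpa [mul_assoc] using this

open Filter Topology in
/-- `G` contains a dense `G_δ` of an open set of a compactification; hence a Baire type statement. -/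
theorem aux_baire {G B : Type u} [TopologicalSpace G] [TopologicalSpace B] [CompactSpace B]
    [T2Space B] (e : G → B) (he : IsEmbedding e) (hd : DenseRange e)
    (V : Set B) (hVo : IsOpen V) (O : ℕ → Set B) (hOo : ∀ n, IsOpen (O n)) (hOd : ∀ n, Dense (O n))
    (hVO : V ∩ ⋂ n, O n ⊆ range e)
    (T : Set G) (hTo : IsOpen T) (hTn : T.Nonempty) (hTV : T ⊆ e ⁻¹' V)
    (D : ℕ → Set G) (hDo : ∀ n, IsOpen (D n)) (hDd : ∀ n, Dense (D n)) :
    ∃ r ∈ T, ∀ n, r ∈ D n := by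
  have h1 : ∀ n, ∃ Q : Set B, IsOpen Q ∧ e ⁻¹' Q = D n := fun n => he.isOpen_iff.1 (hDo n)
  choose Q hQo hQD using h1
  have hQd : ∀ n, Dense (Q n) := by
    intro n
    have := hd.dense_image he.continuous (hDd n)
    refine this.mono ?_
    rw [← hQD n]
    exact image_preimage_subset _ _
  have h2 : Dense (⋂ n, O n ∩ Q n) :=
    dense_iInter_of_isOpen_nat (fun n => (hOo n).inter (hQo n))
      (fun n => (hOd n).inter_of_isOpen_left (hQd n) (hOo n))
  obtain ⟨T', hT'o, hT'⟩ := he.isOpen_iff.1 hTo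
  obtain ⟨t, ht⟩ := hTn
  have ht' : e t ∈ T' := by rw [← hT'] at ht; exact ht
  obtain ⟨b, ⟨hbT, hbV⟩, hb⟩ := h2.inter_open_nonempty (T' ∩ V) (hT'o.inter hVo)
    ⟨e t, ht', hTV ht⟩
  have hb' := mem_iInter.1 hb
  obtain ⟨r, rfl⟩ := hVO ⟨hbV, mem_iInter.2 fun n => (hb' n).1⟩
  refine ⟨r, ?_, fun n => ?_⟩
  · rw [← hT']; exact hbT
  · rw [← hQD n]; exact (hb' n).2

open Filter Topology in
theorem aux_main {G B : Type u} [TopologicalSpace G] [Group G] [IsTopologicalGroup G]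
    [TopologicalSpace B] [CompactSpace B]
    [T2Space B] (e : G → B) (he : IsEmbedding e) (hd : DenseRange e)
    (V : Set B) (hVo : IsOpen V) (hVn : V.Nonempty)
    (O : ℕ → Set B) (hOo : ∀ n, IsOpen (O n)) (hOd : ∀ n, Dense (O n))
    (hVO : V ∩ ⋂ n, O n ⊆ range e)
    (F : Ultrafilter G)
    (hL : ∀ W ∈ 𝓝 (1 : G), ∃ E ∈ F, ∀ a ∈ E, ∀ b ∈ E, a⁻¹ * b ∈ W)
    (hR : ∀ W ∈ 𝓝 (1 : G), ∃ E ∈ F, ∀ a ∈ E, ∀ b ∈ E, a * b⁻¹ ∈ W) :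
    ∃ x, (F : Filter G) ≤ 𝓝 x := by
  -- the dense open sets
  set D : ℕ → Set G := fun n => interior {p | ∃ C, IsClosed C ∧ C ⊆ O n ∧
    ∃ E ∈ F, ∀ z ∈ E, e (z * p) ∈ C} with hD
  have hstep : ∀ (s : G) (A : Set B), A ∈ 𝓝 (e s) → ∃ C, IsClosed C ∧ C ⊆ A ∧
      ∃ S ∈ 𝓝 (1 : G), ∃ T ∈ 𝓝 s, ∀ a ∈ S, ∀ b ∈ T, e (a * b) ∈ C := by
    intro s A hA
    obtain ⟨C, hC, hCc, hCA⟩ := exists_mem_nhds_isClosed_subset hA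
    refine ⟨C, hCc, hCA, ?_⟩
    have : Continuous (fun p : G × G => e (p.1 * p.2)) :=
      he.continuous.comp (continuous_fst.mul continuous_snd)
    have h2 := this.tendsto (1, s)
    simp only [one_mul] at h2
    have h3 := h2 hC
    rw [nhds_prod_eq] at h3
    obtain ⟨S, hS, T, hT, h⟩ := mem_prod_iff.1 h3
    exact ⟨S, hS, T, hT, fun a ha b hb => h (mk_mem_prod ha hb)⟩
  have hDd : ∀ n, Dense (D n) := by
    intro n p0
    rw [mem_closure_iff_nhds]
    intro N0 hN0
    have hcw : Continuous (fun p : G × G => p.1 * p.2 * p0) := by fun_prop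
    have h1 := hcw.tendsto (1, 1)
    simp only [one_mul] at h1
    have h2 := h1 hN0
    rw [nhds_prod_eq] at h2
    obtain ⟨W, hW, hWN⟩ := mem_prod_same_iff.1 h2
    obtain ⟨E1, hE1, hE1W⟩ := hL W hW
    obtain ⟨z', hz'⟩ := Ultrafilter.nonempty_of_mem hE1
    have hOd' : Dense (e ⁻¹' (O n)) := by
      rw [dense_iff_inter_open]
      rintro T hT ⟨t, ht⟩
      obtain ⟨T', hT'o, rfl⟩ := he.isOpen_iff.1 hT
      obtain ⟨r, hr⟩ := hd.exists_mem_open (hT'o.inter (hOo n))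
        ((hOd n).inter_open_nonempty T' hT'o ⟨e t, ht⟩)
      exact ⟨r, hr⟩
    obtain ⟨w, hwO, hwW⟩ : ∃ w, z' * w * p0 ∈ e ⁻¹' (O n) ∧ w ∈ W := by
      have h3 : Dense ((fun w => z' * w * p0) ⁻¹' (e ⁻¹' (O n))) :=
        hOd'.preimage ((isOpenMap_mul_right p0).comp (isOpenMap_mul_left z'))
      obtain ⟨w, hw1, hw2⟩ := mem_closure_iff_nhds.1 (h3 1) W hW
      exact ⟨w, hw2, hw1⟩
    set s := z' * w * p0 with hs
    obtain ⟨C, hCc, hCO, S, hS, T, hT, hST⟩ := hstep s (O n) ((hOo n).mem_nhds hwO)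
    obtain ⟨E2, hE2, hE2S⟩ := hR S hS
    obtain ⟨z, hz1, hz2⟩ := Ultrafilter.nonempty_of_mem (inter_mem hE1 hE2)
    refine ⟨z⁻¹ * s, ?_, ?_⟩
    · have := hWN (mk_mem_prod (hE1W z hz1 z' hz') hwW)
      simpa [hs, mul_assoc] using this
    · rw [hD, mem_interior_iff_mem_nhds]
      have h4 : Tendsto (fun p => z * p) (𝓝 (z⁻¹ * s)) (𝓝 s) := by
        have := (continuous_const_mul z).tendsto (z⁻¹ * s)
        simpa using this
      filter_upwards [h4 hT] with p hp
      refine ⟨C, hCc, hCO, E2, hE2, fun x hx => ?_⟩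
      have := hST _ (hE2S x hx z hz2) _ hp
      simpa [mul_assoc] using this
  obtain ⟨q, hq⟩ : ∃ q, e q ∈ V := hd.exists_mem_open hVo hVn
  obtain ⟨C, hCc, hCV, S, hS, T, hT, hST⟩ := hstep q V (hVo.mem_nhds hq)
  obtain ⟨E2, hE2, hE2S⟩ := hR S hS
  obtain ⟨y, hy⟩ := Ultrafilter.nonempty_of_mem hE2
  have hVT : T ∩ e ⁻¹' V ∈ 𝓝 q :=
    inter_mem hT (he.continuous.continuousAt (hVo.mem_nhds hq))
  obtain ⟨r, hrT, hrD⟩ := aux_baire e he hd V hVo O hOo hOd hVO (interior (T ∩ e ⁻¹' V))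
    isOpen_interior ⟨q, mem_interior_iff_mem_nhds.2 hVT⟩
    (interior_subset.trans inter_subset_right)
    (fun n => (fun x => y⁻¹ * x) ⁻¹' (D n))
    (fun n => isOpen_interior.preimage (continuous_const_mul _))
    (fun n => (hDd n).preimage (isOpenMap_mul_left _))
  have hrT' := (interior_subset hrT).1
  set p := y⁻¹ * r with hp
  -- limit in `B`
  set f : Ultrafilter B := F.map (fun z => e (z * p)) with hf
  obtain ⟨b, hb⟩ : ∃ b, (f : Filter B) ≤ 𝓝 b := by
    obtain ⟨b, -, hb⟩ := isCompact_iff_ultrafilter_le_nhds.1 (isCompact_univ (X := B)) f (by simp)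
    exact ⟨b, hb⟩
  have hbC : ∀ C : Set B, IsClosed C → (∃ E ∈ F, ∀ z ∈ E, e (z * p) ∈ C) → b ∈ C := by
    rintro C hC ⟨E, hE, h⟩
    have : C ∈ f := by
      have : ∀ᶠ z in (F : Filter G), e (z * p) ∈ C := by
        filter_upwards [hE] with z hz using h z hz
      exact this
    exact aux_closed hC hb this
  have hbV : b ∈ V := by
    refine hCV (hbC C hCc ⟨E2, hE2, fun z hz => ?_⟩)
    have := hST _ (hE2S z hz y hy) _ hrT'
    simpa [hp, mul_assoc] using this
  have hbO : ∀ n, b ∈ O n := by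
    intro n
    obtain ⟨C, hC, hCO, h⟩ := interior_subset (hrD n)
    exact hCO (hbC C hC h)
  obtain ⟨g, rfl⟩ := hVO ⟨hbV, mem_iInter.2 hbO⟩
  have h5 : Tendsto (fun z => z * p) F (𝓝 g) := by
    rw [he.tendsto_nhds_iff]
    exact hb
  have h6 := h5.mul_const p⁻¹
  refine ⟨g * p⁻¹, ?_⟩
  simpa [Tendsto, Filter.map_id'] using h6

open Filter Topology in
theorem aux_sigma {G B : Type u} [TopologicalSpace G] [Group G] [ContinuousMul G]
    [TopologicalSpace B] [CompactSpace B]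
    [T2Space B] (e : G → B) (he : IsEmbedding e) (hd : DenseRange e)
    (U : ℕ → Set G) (hU1 : ∀ n, U n ∈ 𝓝 1)
    (hconv : ∀ F : Ultrafilter G, (∀ n, ∃ y : G, {x | y⁻¹ * x ∈ U n} ∈ F) →
      (∀ n, ∃ y : G, {x | x * y⁻¹ ∈ U n} ∈ F) → ∃ x, (F : Filter G) ≤ 𝓝 x) :
    SigmaCompactSpace ((Set.range e)ᶜ : Set B) := by
  rw [← isSigmaCompact_iff_sigmaCompactSpace]
  set Q : ℕ → Set B := fun n => ⋃₀ {W | IsOpen W ∧ ∃ y : G, e ⁻¹' W ⊆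
    {x | y⁻¹ * x ∈ U n} ∩ {x | x * y⁻¹ ∈ U n}} with hQ
  have hQo : ∀ n, IsOpen (Q n) := fun n => isOpen_sUnion fun W hW => hW.1
  refine ⟨fun n => (Q n)ᶜ, fun n => (hQo n).isClosed_compl.isCompact, ?_⟩
  rw [← compl_iInter, compl_inj_iff]
  apply Subset.antisymm
  · intro b hb
    have hne : (comap e (𝓝 b)).NeBot := by
      rw [comap_neBot_iff]
      intro t ht
      obtain ⟨_, h1, ⟨g, rfl⟩⟩ := mem_closure_iff_nhds.1 (hd b) t ht
      exact ⟨g, h1⟩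
    set F := Ultrafilter.of (comap e (𝓝 b)) with hF
    have hFle : (F : Filter G) ≤ comap e (𝓝 b) := Ultrafilter.of_le _
    have h1 : ∀ n, ∃ y : G, {x | y⁻¹ * x ∈ U n} ∩ {x | x * y⁻¹ ∈ U n} ∈ F := by
      intro n
      obtain ⟨W, ⟨hWo, y, hy⟩, hbW⟩ := mem_iInter.1 hb n
      exact ⟨y, mem_of_superset (hFle (preimage_mem_comap (hWo.mem_nhds hbW))) hy⟩
    obtain ⟨x, hx⟩ := hconv F
      (fun n => (h1 n).imp fun y hy => mem_of_superset hy inter_subset_left)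
      (fun n => (h1 n).imp fun y hy => mem_of_superset hy inter_subset_right)
    have h2 : Tendsto e F (𝓝 (e x)) := (he.continuous.tendsto x).mono_left hx
    have h3 : Tendsto e F (𝓝 b) := tendsto_comap.mono_left hFle
    exact ⟨x, tendsto_nhds_unique h2 h3⟩
  · rintro _ ⟨g, rfl⟩
    refine mem_iInter.2 fun n => ?_
    have h1 : {x | g⁻¹ * x ∈ U n} ∩ {x | x * g⁻¹ ∈ U n} ∈ 𝓝 g := by
      refine inter_mem ?_ ?_
      · have := (continuous_const_mul g⁻¹).tendsto g
        rw [inv_mul_cancel] at this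
        exact this (hU1 n)
      · have := (continuous_mul_const g⁻¹).tendsto g
        rw [mul_inv_cancel] at this
        exact this (hU1 n)
    rw [he.isInducing.nhds_eq_comap] at h1
    obtain ⟨t, ht, hts⟩ := mem_comap.1 h1
    obtain ⟨W, hWt, hWo, hgW⟩ := mem_nhds_iff.1 ht
    exact ⟨W, ⟨hWo, g, (preimage_mono hWt).trans hts⟩, hgW⟩

open Filter Topology in
theorem aux_exU {G B : Type u} [TopologicalSpace G] [Group G] [ContinuousMul G]
    [TopologicalSpace B] [CompactSpace B]
    [T2Space B] (e : G → B) (he : IsEmbedding e)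
    (V : Set B) (hVo : IsOpen V) (hVn : V.Nonempty)
    (O : ℕ → Set B) (hOo : ∀ n, IsOpen (O n)) (hOd : ∀ n, Dense (O n))
    (hVO : V ∩ ⋂ n, O n ⊆ range e) :
    ∃ U : ℕ → Set G, (∀ n, U n ∈ 𝓝 1) ∧ (∀ n, IsClosed (U n)) ∧ Antitone U ∧
    ∀ f : Ultrafilter G, (∀ n, U n ∈ f) → ∃ x, (f : Filter G) ≤ 𝓝 x := by
  obtain ⟨a, haV, haO⟩ := (dense_iInter_of_isOpen_nat hOo hOd).inter_open_nonempty V hVo hVn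
  obtain ⟨g, rfl⟩ := hVO ⟨haV, haO⟩
  have h1 : ∀ n, ∃ C ∈ 𝓝 (e g), IsClosed C ∧ C ⊆ V ∩ O n := fun n =>
    exists_mem_nhds_isClosed_subset
      (inter_mem (hVo.mem_nhds haV) ((hOo n).mem_nhds (mem_iInter.1 haO n)))
  choose C hC hCc hCs using h1
  have hcont : Continuous (fun x => e (g * x)) := he.continuous.comp (continuous_const_mul g)
  refine ⟨fun n => ⋂ k ∈ Finset.range (n + 1), (fun x => e (g * x)) ⁻¹' (C k), ?_, ?_, ?_, ?_⟩
  · intro n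
    rw [biInter_finset_mem]
    intro k _
    have := hcont.tendsto 1
    simp only [mul_one] at this
    exact this (hC k)
  · intro n
    exact isClosed_biInter fun k _ => (hCc k).preimage hcont
  · intro m n hmn
    refine biInter_subset_biInter_left ?_
    intro k hk
    have := Finset.mem_range.1 hk
    exact Finset.mem_range.2 (by omega)
  · intro f hf
    obtain ⟨b, -, hb⟩ := isCompact_iff_ultrafilter_le_nhds.1 (isCompact_univ (X := B))
      (f.map (fun x => e (g * x))) (by simp)
    have hbC : ∀ n, b ∈ C n := by
      intro n
      have : C n ∈ f.map (fun x => e (g * x)) := by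
        rw [Ultrafilter.mem_map]
        refine mem_of_superset (hf n) ?_
        exact biInter_subset_of_mem (by simp)
      exact aux_closed (hCc n) hb this
    obtain ⟨x, rfl⟩ := hVO ⟨(hCs 0 (hbC 0)).1, mem_iInter.2 fun n => (hCs n (hbC n)).2⟩
    have h5 : Tendsto (fun z => g * z) f (𝓝 x) := by
      rw [he.tendsto_nhds_iff]
      exact hb
    have h6 := h5.const_mul g⁻¹
    refine ⟨g⁻¹ * x, ?_⟩
    simpa [Tendsto, Filter.map_id'] using h6

open Filter Topology in
theorem aux_dense {G B : Type u} [TopologicalSpace G] [T2Space G] [Group G] [ContinuousMul G]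
    (hnlc : ¬ LocallyCompactSpace G)
    [TopologicalSpace B] [CompactSpace B]
    [T2Space B] (e : G → B) (he : IsEmbedding e) (hd : DenseRange e) :
    Dense (range e)ᶜ := by
  rw [← interior_eq_empty_iff_dense_compl]
  by_contra hne
  rw [← Ne, ← nonempty_iff_ne_empty] at hne
  obtain ⟨g, hg⟩ := hd.exists_mem_open isOpen_interior hne
  obtain ⟨C, hC, hCc, hCs⟩ := exists_mem_nhds_isClosed_subset (isOpen_interior.mem_nhds hg)
  have hK : IsCompact (e ⁻¹' C) :=
    he.isInducing.isCompact_preimage' hCc.isCompact (hCs.trans interior_subset)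
  have hKn : e ⁻¹' C ∈ 𝓝 g := he.continuous.continuousAt hC
  apply hnlc
  have : WeaklyLocallyCompactSpace G := by
    refine ⟨fun x => ⟨(fun z => x * g⁻¹ * z) '' (e ⁻¹' C), hK.image (continuous_const_mul _), ?_⟩⟩
    have h1 : Tendsto (fun z => g * x⁻¹ * z) (𝓝 x) (𝓝 g) := by
      have := (continuous_const_mul (g * x⁻¹)).tendsto x
      simpa using this
    filter_upwards [h1 hKn] with z hz
    exact ⟨g * x⁻¹ * z, hz, by group⟩
  infer_instance

open Filter Topology in
theorem aux_notBaire {B : Type u} [TopologicalSpace B] (R : Set B) (hR : Dense R)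
    (h : ¬ BaireSpace R) : ∃ V : Set B, IsOpen V ∧ V.Nonempty ∧ ∃ O : ℕ → Set B,
      (∀ n, IsOpen (O n)) ∧ (∀ n, Dense (O n)) ∧ V ∩ ⋂ n, O n ⊆ Rᶜ := by
  by_contra hcon
  apply h
  refine ⟨fun f hfo hfd => ?_⟩
  have h1 : ∀ n, ∃ Q : Set B, IsOpen Q ∧ Subtype.val ⁻¹' Q = f n := fun n =>
    isOpen_induced_iff.1 (hfo n)
  choose O hOo hOf using h1
  have hOd : ∀ n, Dense (O n) := by
    intro n
    have h2 : DenseRange (Subtype.val : R → B) := by simpa [DenseRange] using hR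
    refine (h2.dense_image continuous_subtype_val (hfd n)).mono ?_
    rw [← hOf n]
    exact image_preimage_subset _ _
  rw [dense_iff_inter_open]
  rintro T hT ⟨r, hr⟩
  obtain ⟨V, hVo, rfl⟩ := isOpen_induced_iff.1 hT
  by_contra hemp
  refine hcon ⟨V, hVo, ⟨r, hr⟩, O, hOo, hOd, ?_⟩
  rintro x ⟨hxV, hxO⟩ hxR
  refine hemp ⟨⟨x, hxR⟩, hxV, mem_iInter.2 fun n => ?_⟩
  rw [← hOf n]
  exact mem_iInter.1 hxO n

/-- if `G` is a non-locally compact `k`-gentle paratopological group (the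
inversion map sends compact sets to compact sets), then either every remainder of `G` is
Baire, or every remainder of `G` is σ-compact. -/
theorem stmt5 {G : Type u} [TopologicalSpace G] [T35Space G] [Group G] [ContinuousMul G]
    (hnlc : ¬ LocallyCompactSpace G)
    (hk : ∀ K : Set G, IsCompact K → IsCompact ((fun x => x⁻¹) '' K)) :
    (∀ (B : Type u) (tB : TopologicalSpace B) (e : G → B), by
      haveI := tB
      exact CompactSpace B → T2Space B → Topology.IsEmbedding e → DenseRange e →
        BaireSpace ((Set.range e)ᶜ : Set B)) ∨
    (∀ (B : Type u) (tB : TopologicalSpace B) (e : G → B), by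
      haveI := tB
      exact CompactSpace B → T2Space B → Topology.IsEmbedding e → DenseRange e →
        SigmaCompactSpace ((Set.range e)ᶜ : Set B)) := by
  by_cases hB : ∀ (B : Type u) (tB : TopologicalSpace B) (e : G → B), CompactSpace B → T2Space B →
      Topology.IsEmbedding e → DenseRange e → BaireSpace ((Set.range e)ᶜ : Set B)
  · exact Or.inl hB
  right
  push Not at hB
  obtain ⟨B, tB, e, hcB, hT2, he, hd, hnB⟩ := hB
  obtain ⟨V, hVo, hVn, O, hOo, hOd, hVO⟩ := aux_notBaire _ (aux_dense hnlc e he hd) hnB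
  rw [compl_compl] at hVO
  obtain ⟨U, hU1, hUc, hUa, hUu⟩ := aux_exU e he V hVo hVn O hOo hOd hVO
  have hG : IsTopologicalGroup G := aux_inv hk U hU1 hUc hUa hUu
  intro B' tB' e' hc' hT2' he' hd'
  exact aux_sigma e' he' hd' U hU1 fun F hL hR =>
    aux_main e he hd V hVo hVn O hOo hOd hVO F
      (aux_left U hUc hUa hUu F hL) (aux_right U hUc hUa hUu F hR)
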